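/- Let (k_i)_{i≥1} be a sequence of positive integers satisfying condition (★). The subshift (X,σ) is linearly recurrent if and only if the sequence (k_i)_{i≥1} is bounded and both sets {i : k_{2i} > 1} and {i : k_{2i-1} > 1} have bounded gaps, i.e., there exists N ∈ ℕ such that for every i there are j, j' ∈ {i, i+1, …, i+N} with k_{2j} > 1 and k_{2j'-1} > 1. -/

import Mathlib

open Filter Topology MeasureTheory

/-- The substitution `χ_k` on the alphabet `{1,2,3}`, coded as `Fin 3 = {0,1,2}`
(letter 1 ↦ 0, letter 2 ↦ 1, letter 3 ↦ 2):
`χ_k(1) = 2`, `χ_k(2) = 3 1^k`, `χ_k(3) = 3 1^(k-1)`. -/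
def chiSub (k : ℕ) : Fin 3 → List (Fin 3) :=
  ![[1], 2 :: List.replicate k 0, 2 :: List.replicate (k - 1) 0]

/-- Extension of `χ_k` to finite words by concatenation. -/
def applyChi (k : ℕ) (w : List (Fin 3)) : List (Fin 3) := w.flatMap (chiSub k)

/-- `compApply k n w = χ_{k 1} ∘ χ_{k 2} ∘ ⋯ ∘ χ_{k n} (w)`. -/
def compApply (k : ℕ → ℕ) : ℕ → List (Fin 3) → List (Fin 3)
  | 0, w => w
  | n + 1, w => compApply k n (applyChi (k (n + 1)) w)

/-- Condition (★): k_{2i} > 1` for infinitely many `i` and `k_{2i-1} > 1`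
for infinitely many `i`. -/
def StarCond (k : ℕ → ℕ) : Prop :=
  (∀ N, ∃ i ≥ N, 1 < k (2 * i)) ∧ (∀ N, ∃ i ≥ N, 1 < k (2 * i - 1))

/-- `w` is a prefix of the infinite sequence `x`. -/
def IsPrefixSeq (w : List (Fin 3)) (x : ℕ → Fin 3) : Prop :=
  w = List.ofFn fun i : Fin w.length => x i

/-- The left shift `σ`. -/
def shift (x : ℕ → Fin 3) : ℕ → Fin 3 := fun i => x (i + 1)

/-- The closure of the `σ`-orbit of `ρ`: the subshift `X`. -/
def orbitClosure (ρ : ℕ → Fin 3) : Set (ℕ → Fin 3) :=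
  closure {y | ∃ n : ℕ, y = fun i => ρ (i + n)}

/-- The word `w` occurs in the sequence `x`. -/
def OccursIn (w : List (Fin 3)) (x : ℕ → Fin 3) : Prop :=
  ∃ p : ℕ, w = List.ofFn fun i : Fin w.length => x (p + i)

/-- A subshift `X` is linearly recurrent if there is `L` such that every word `w`
occurring in some `x ∈ X` occurs in every window `x_m x_{m+1} ⋯ x_{m+L|w|-1}`. -/
def LinearlyRecurrent (X : Set (ℕ → Fin 3)) : Prop :=
  ∃ L : ℕ, ∀ x ∈ X, ∀ w : List (Fin 3), OccursIn w x →
    ∀ m : ℕ, w <:+: List.ofFn fun i : Fin (L * w.length) => x (m + i)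

section Morphism

variable (k : ℕ → ℕ)

theorem applyChi_append (j : ℕ) (u v : List (Fin 3)) :
    applyChi j (u ++ v) = applyChi j u ++ applyChi j v := by
  simp [applyChi]

theorem applyChi_cons (j : ℕ) (a : Fin 3) (v : List (Fin 3)) :
    applyChi j (a :: v) = chiSub j a ++ applyChi j v := by
  simp [applyChi]

theorem compApply_append (n : ℕ) (u v : List (Fin 3)) :
    compApply k n (u ++ v) = compApply k n u ++ compApply k n v := by
  induction n generalizing u v with
  | zero => rfl
  | succ n ih => simp only [compApply, applyChi_append, ih]

@[simp]
theorem compApply_nil (n : ℕ) : compApply k n [] = [] := by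
  induction n with
  | zero => rfl
  | succ n ih => simpa [compApply, applyChi] using ih

theorem compApply_cons (n : ℕ) (a : Fin 3) (v : List (Fin 3)) :
    compApply k n (a :: v) = compApply k n [a] ++ compApply k n v :=
  compApply_append k n [a] v

theorem infix_compApply_of_mem (n : ℕ) {a : Fin 3} {v : List (Fin 3)} (h : a ∈ v) :
    compApply k n [a] <:+: compApply k n v := by
  obtain ⟨s, t, rfl⟩ := List.append_of_mem h
  rw [compApply_append, compApply_cons k n a t, ← List.append_assoc]
  exact List.infix_append _ _ _

theorem compApply_eq_flatMap (n : ℕ) (w : List (Fin 3)) :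
    compApply k n w = w.flatMap fun a => compApply k n [a] := by
  induction w with
  | nil => simp
  | cons a w ih => rw [compApply_cons, ih, List.flatMap_cons]

theorem compApply_add (n m : ℕ) (w : List (Fin 3)) :
    compApply k (n + m) w = compApply k n (compApply (fun i => k (n + i)) m w) := by
  induction m generalizing w with
  | zero => rfl
  | succ m ih => exact ih (applyChi (k (n + (m + 1))) w)

theorem compApply_succ_zero (n : ℕ) : compApply k (n + 1) [0] = compApply k n [1] := by
  simp [compApply, applyChi, chiSub]

theorem compApply_succ_one (n : ℕ) :
    compApply k (n + 1) [1] =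
      compApply k n [2] ++ compApply k n (List.replicate (k (n + 1)) 0) := by
  rw [← compApply_append]
  simp [compApply, applyChi, chiSub]

theorem compApply_succ_two (n : ℕ) :
    compApply k (n + 1) [2] =
      compApply k n [2] ++ compApply k n (List.replicate (k (n + 1) - 1) 0) := by
  rw [← compApply_append]
  simp [compApply, applyChi, chiSub]

theorem length_compApply_replicate (n j : ℕ) (a : Fin 3) :
    (compApply k n (List.replicate j a)).length = j * (compApply k n [a]).length := by
  induction j with
  | zero => simp
  | succ j ih =>
    rw [List.replicate_succ, compApply_cons, List.length_append, ih]
    ring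

theorem length_succ_zero (n : ℕ) :
    (compApply k (n + 1) [0]).length = (compApply k n [1]).length := by
  rw [compApply_succ_zero]

theorem length_succ_one (n : ℕ) :
    (compApply k (n + 1) [1]).length =
      (compApply k n [2]).length + k (n + 1) * (compApply k n [0]).length := by
  rw [compApply_succ_one, List.length_append, length_compApply_replicate]

theorem length_succ_two (n : ℕ) :
    (compApply k (n + 1) [2]).length =
      (compApply k n [2]).length + (k (n + 1) - 1) * (compApply k n [0]).length := by
  rw [compApply_succ_two, List.length_append, length_compApply_replicate]

theorem length_two_mono : Monotone fun n => (compApply k n [2]).length := by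
  refine monotone_nat_of_le_succ fun n => ?_
  rw [length_succ_two]
  exact Nat.le_add_right _ _

theorem length_compApply_pos (n : ℕ) {v : List (Fin 3)} (hv : v ≠ []) :
    0 < (compApply k n v).length := by
  induction n generalizing v with
  | zero => exact List.length_pos_iff.2 hv
  | succ n ih =>
    refine ih ?_
    obtain ⟨a, v, rfl⟩ := List.exists_cons_of_ne_nil hv
    rw [applyChi_cons]
    fin_cases a <;> simp [chiSub]

theorem compApply_two_prefix_of_le {n m : ℕ} (h : n ≤ m) :
    compApply k n [2] <+: compApply k m [2] := by
  induction m, h using Nat.le_induction with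
  | base => exact List.prefix_rfl
  | succ m _ ih =>
    rw [compApply_succ_two]
    exact ih.trans (List.prefix_append _ _)

/-- The composition of two substitutions maps every letter to a word starting with `3`. -/
theorem compApply_two_prefix_add_two (n : ℕ) {v : List (Fin 3)} (hv : v ≠ []) :
    compApply k n [2] <+: compApply k (n + 2) v := by
  obtain ⟨a, v, rfl⟩ := List.exists_cons_of_ne_nil hv
  rw [compApply_cons k (n + 2)]
  refine List.IsPrefix.trans ?_ (List.prefix_append _ _)
  fin_cases a
  · change _ <+: compApply k (n + 1 + 1) [0]
    rw [compApply_succ_zero, compApply_succ_one]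
    exact List.prefix_append _ _
  · change _ <+: compApply k (n + 1 + 1) [1]
    rw [compApply_succ_one]
    exact (compApply_two_prefix_of_le k n.le_succ).trans (List.prefix_append _ _)
  · exact compApply_two_prefix_of_le k (by omega)

end Morphism

section Recognizability

theorem applyChi_ne_zero_cons (j : ℕ) (w t : List (Fin 3)) : applyChi j w ≠ 0 :: t := by
  cases w with
  | nil => simp [applyChi]
  | cons a w =>
    rw [applyChi_cons]
    fin_cases a <;> simp [chiSub]

theorem exists_of_applyChi_eq_append_one {j : ℕ} {v x y : List (Fin 3)}
    (h : applyChi j v = x ++ 1 :: y) :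
    ∃ v₁ v₂, v = v₁ ++ 0 :: v₂ ∧ applyChi j v₁ = x := by
  induction v generalizing x with
  | nil => simp [applyChi] at h
  | cons a v ih =>
    rw [applyChi_cons] at h
    have step : ∀ x', x = chiSub j a ++ x' → applyChi j v = x' ++ 1 :: y →
        ∃ v₁ v₂, a :: v = v₁ ++ 0 :: v₂ ∧ applyChi j v₁ = x := by
      rintro x' rfl h'
      obtain ⟨v₁, v₂, rfl, rfl⟩ := ih h'
      exact ⟨a :: v₁, v₂, rfl, applyChi_cons _ _ _⟩
    rcases List.append_eq_append_iff.1 h with ⟨x', hx, h'⟩ | ⟨c, hc, h'⟩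
    · exact step x' hx h'
    · rcases c with _ | ⟨b, c⟩
      · exact step [] (by simpa using hc.symm) h'.symm
      · obtain ⟨rfl, -⟩ := List.cons_eq_cons.1 h'
        have h1 : (1 : Fin 3) ∈ chiSub j a := by simp [hc]
        fin_cases a
        · have : x = [] := by
            rcases x with _ | ⟨b, x⟩
            · rfl
            · simp [chiSub] at hc
          exact ⟨[], v, rfl, by simp [applyChi, this]⟩
        · simp [chiSub] at h1
        · simp [chiSub] at h1

theorem exists_of_applyChi_eq_append_replicate {j : ℕ} (hj : 1 ≤ j) {w x y : List (Fin 3)}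
    (h : applyChi j w = x ++ (List.replicate j 0 ++ y)) :
    ∃ w₁ w₂, w = w₁ ++ 1 :: w₂ ∧ applyChi j w₁ ++ [2] = x := by
  induction w generalizing x with
  | nil =>
    have := congrArg List.length h
    simp [applyChi] at this
    omega
  | cons a w ih =>
    rw [applyChi_cons] at h
    have step : ∀ x', x = chiSub j a ++ x' → applyChi j w = x' ++ (List.replicate j 0 ++ y) →
        ∃ w₁ w₂, a :: w = w₁ ++ 1 :: w₂ ∧ applyChi j w₁ ++ [2] = x := by
      rintro x' rfl h'
      obtain ⟨w₁, w₂, rfl, rfl⟩ := ih h'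
      exact ⟨a :: w₁, w₂, rfl, by simp [applyChi_cons]⟩
    rcases List.append_eq_append_iff.1 h with ⟨x', hx, h'⟩ | ⟨c, hc, h'⟩
    · exact step x' hx h'
    · by_cases hc0 : c = []
      · subst hc0
        exact step [] (by simpa using hc.symm) h'.symm
      have key : ∀ i ≤ j, chiSub j a = 2 :: List.replicate i 0 → i = j ∧ x = [2] := by
        intro i hi hia
        rw [hia] at hc
        rcases x with _ | ⟨b, z⟩
        · obtain ⟨j, rfl⟩ : ∃ t, j = t + 1 := ⟨j - 1, by omega⟩
          rw [List.nil_append] at hc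
          rw [← hc, List.replicate_succ] at h'
          simp at h'
        · obtain ⟨rfl, hz⟩ := List.cons_eq_cons.1 hc
          obtain ⟨hlen, hz1, hc1⟩ := List.append_eq_replicate_iff.1 hz.symm
          by_cases hcj : c.length < j
          · exfalso
            rw [hc1, show j = c.length + ((j - c.length - 1) + 1) by omega, List.replicate_add,
              List.append_assoc] at h'
            have := List.append_cancel_left h'
            rw [List.replicate_succ, List.cons_append] at this
            exact applyChi_ne_zero_cons _ _ _ this.symm
          · have : z = [] := List.length_eq_zero_iff.1 (by omega)
            exact ⟨by omega, by rw [this]⟩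
      fin_cases a
      · exfalso
        rcases x with _ | ⟨b, z⟩
        · obtain ⟨j, rfl⟩ : ∃ t, j = t + 1 := ⟨j - 1, by omega⟩
          rw [List.nil_append] at hc
          rw [← hc, List.replicate_succ] at h'
          simp [chiSub] at h'
        · simp [chiSub, hc0] at hc
      · exact ⟨[], w, rfl, by simp [applyChi, (key j le_rfl (by simp [chiSub])).2]⟩
      · have := (key (j - 1) (by omega) (by simp [chiSub])).1
        omega

variable {k : ℕ → ℕ}

theorem exists_of_compApply_eq_append_replicate {n : ℕ}
    (hn : ∀ v x y, compApply k n v = x ++ (compApply k n [0] ++ y) →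
      ∃ v₁ v₂, v = v₁ ++ 0 :: v₂ ∧ compApply k n v₁ = x)
    (j : ℕ) {v x y : List (Fin 3)}
    (h : compApply k n v = x ++ (compApply k n (List.replicate (j + 1) 0) ++ y)) :
    ∃ v₁ v₂, v = v₁ ++ (List.replicate (j + 1) 0 ++ v₂) ∧ compApply k n v₁ = x := by
  induction j generalizing v x with
  | zero => exact hn v x y h
  | succ j ih =>
    rw [List.replicate_succ, compApply_cons, List.append_assoc] at h
    obtain ⟨v₁, v₂, rfl, rfl⟩ := hn _ _ _ h
    rw [compApply_append, compApply_cons] at h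
    have h' := List.append_cancel_left (List.append_cancel_left h)
    obtain ⟨u₁, u₂, rfl, hu⟩ := ih (x := []) h'
    have : u₁ = [] := by
      by_contra hne
      have := length_compApply_pos k n hne
      simp [hu] at this
    subst this
    exact ⟨v₁, u₂, by simp [List.replicate_succ], rfl⟩

/-- Every occurrence of the image of the letter `1` is the image of an occurrence of `1`. -/
theorem exists_of_compApply_eq_append (hpos : ∀ i, 1 ≤ i → 1 ≤ k i) (n : ℕ) :
    ∀ v x y, compApply k n v = x ++ (compApply k n [0] ++ y) →
      ∃ v₁ v₂, v = v₁ ++ 0 :: v₂ ∧ compApply k n v₁ = x := by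
  induction n using Nat.twoStepInduction with
  | zero => exact fun v x y h => ⟨x, y, h, rfl⟩
  | one =>
    intro v x y h
    rw [compApply_succ_zero] at h
    exact exists_of_applyChi_eq_append_one h
  | more n ih _ =>
    intro v x y h
    rw [compApply_succ_zero, compApply_succ_one, List.append_assoc, ← List.append_assoc x] at h
    obtain ⟨j, hj⟩ : ∃ j, k (n + 1) = j + 1 := ⟨k (n + 1) - 1, by have := hpos (n + 1); omega⟩
    rw [hj] at h
    obtain ⟨u₁, u₂, hu, hx⟩ := exists_of_compApply_eq_append_replicate ih j h
    rw [← hj] at hu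
    obtain ⟨w₁, w₂, hw, rfl⟩ := exists_of_applyChi_eq_append_replicate (hpos _ (by omega)) hu
    obtain ⟨v₁, v₂, rfl, rfl⟩ := exists_of_applyChi_eq_append_one hw
    refine ⟨v₁, v₂, rfl, ?_⟩
    rw [compApply_append] at hx
    exact List.append_cancel_right hx

theorem zero_mem_of_compApply_infix_compApply (hpos : ∀ i, 1 ≤ i → 1 ≤ k i) {n : ℕ}
    {v : List (Fin 3)} (h : compApply k n [0] <:+: compApply k n v) : (0 : Fin 3) ∈ v := by
  obtain ⟨x, y, hxy⟩ := h
  obtain ⟨v₁, v₂, rfl, -⟩ :=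
    exists_of_compApply_eq_append hpos n v x y (by rw [← hxy, List.append_assoc])
  simp

end Recognizability

section Windows

/-- The word `x_p x_{p+1} ⋯ x_{p+l-1}`. -/
def window (x : ℕ → Fin 3) (p l : ℕ) : List (Fin 3) := List.ofFn fun i : Fin l => x (p + i)

@[simp]
theorem length_window (x : ℕ → Fin 3) (p l : ℕ) : (window x p l).length = l := by
  simp [window]

theorem window_add (x : ℕ → Fin 3) (p a b : ℕ) :
    window x p (a + b) = window x p a ++ window x (p + a) b := by
  refine List.ext_getElem (by simp) fun i h₁ h₂ => ?_
  by_cases hi : i < a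
  · rw [List.getElem_append_left (by simpa using hi)]
    simp [window]
  · rw [List.getElem_append_right (by simpa using hi)]
    simp only [window, List.getElem_ofFn, List.length_ofFn]
    congr 1
    omega

theorem window_infix_window (x : ℕ → Fin 3) {p l p' l' : ℕ} (hp : p ≤ p') (hl : p' + l' ≤ p + l) :
    window x p' l' <:+: window x p l := by
  obtain ⟨a, rfl⟩ := Nat.exists_eq_add_of_le hp
  obtain ⟨b, rfl⟩ : ∃ b, l = a + l' + b := ⟨l - (a + l'), by omega⟩
  exact ⟨window x p a, window x (p + (a + l')) b, by rw [window_add, window_add]⟩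

theorem exists_eq_window_of_infix_window {x : ℕ → Fin 3} {p l : ℕ} {u : List (Fin 3)}
    (h : u <:+: window x p l) : ∃ q, u = window x q u.length := by
  obtain ⟨s, t, hst⟩ := h
  have hl : l = s.length + u.length + t.length := by
    simpa [add_assoc] using (congrArg List.length hst).symm
  rw [hl, window_add, window_add] at hst
  have h₁ := (List.append_inj hst (by simp)).1
  exact ⟨_, (List.append_inj h₁ (by simp)).2⟩

theorem exists_window_eq_of_mem_orbitClosure {ρ x : ℕ → Fin 3} (hx : x ∈ orbitClosure ρ)
    (p l : ℕ) : ∃ q, window x p l = window ρ q l := by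
  obtain ⟨y, hy, n, rfl⟩ := mem_closure_iff.1 hx
    (Set.pi (Finset.range (p + l) : Set ℕ) fun i => {x i})
    (isOpen_set_pi (Finset.finite_toSet _) fun i _ => isOpen_discrete _) (by simp)
  refine ⟨p + n, ?_⟩
  refine congrArg List.ofFn (funext fun i => ?_)
  have : ρ (p + i + n) = x (p + i) := hy (p + i) (by simp)
  rw [← this]
  congr 1
  omega

theorem self_mem_orbitClosure (ρ : ℕ → Fin 3) : ρ ∈ orbitClosure ρ :=
  subset_closure ⟨0, rfl⟩

theorem linearlyRecurrent_orbitClosure_iff (ρ : ℕ → Fin 3) :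
    LinearlyRecurrent (orbitClosure ρ) ↔
      ∃ L, ∀ p l m, window ρ p l <:+: window ρ m (L * l) := by
  constructor
  · rintro ⟨L, hL⟩
    refine ⟨L, fun p l m => ?_⟩
    have h := hL ρ (self_mem_orbitClosure ρ) (window ρ p l)
      ⟨p, by conv_lhs => rw [← length_window ρ p l]
             rfl⟩ m
    change _ <:+: window ρ m _ at h
    rwa [length_window] at h
  · rintro ⟨L, hL⟩
    refine ⟨L, fun x hx w ⟨p, hp⟩ m => ?_⟩
    change w = window x p w.length at hp
    change w <:+: window x m _
    obtain ⟨q, hq⟩ := exists_window_eq_of_mem_orbitClosure hx p w.length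
    obtain ⟨r, hr⟩ := exists_window_eq_of_mem_orbitClosure hx m (L * w.length)
    rw [hr, hp.trans hq, length_window]
    exact hL _ _ _

end Windows

section Necessity

variable {k : ℕ → ℕ} {ρ : ℕ → Fin 3}

theorem compApply_eq_window (hρ : ∀ n, IsPrefixSeq (compApply k n [2]) ρ) (n : ℕ) :
    compApply k n [2] = window ρ 0 (compApply k n [2]).length := by
  have h := hρ n
  simp only [IsPrefixSeq] at h
  simpa [window] using h

theorem compApply_zero_infix_add_two (hpos : ∀ i, 1 ≤ i → 1 ≤ k i) (n j : ℕ) :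
    compApply k n [0] <:+: compApply k (n + 2 * j) [0] := by
  induction j with
  | zero => exact List.infix_rfl
  | succ j ih =>
    refine ih.trans ?_
    change _ <:+: compApply k (n + 2 * j + 1 + 1) [0]
    rw [compApply_succ_zero, compApply_succ_one]
    have := hpos (n + 2 * j + 1) (by omega)
    exact (infix_compApply_of_mem k _ (List.mem_replicate.2 ⟨by omega, rfl⟩)).trans
      (List.suffix_append _ _).isInfix

theorem exists_zero_infix_compApply (hpos : ∀ i, 1 ≤ i → 1 ≤ k i) (hstar : StarCond k) (n : ℕ) :
    ∃ N, compApply k n [0] <:+: compApply k N [2] := by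
  obtain ⟨j, hj⟩ : ∃ j, 1 < k (n + 2 * j + 1) := by
    obtain ⟨s, hs | hs⟩ := n.even_or_odd'
    · obtain ⟨i, hi, h⟩ := hstar.2 (s + 1)
      exact ⟨i - s - 1, by convert h using 2; omega⟩
    · obtain ⟨i, hi, h⟩ := hstar.1 (s + 1)
      exact ⟨i - s - 1, by convert h using 2; omega⟩
  refine ⟨n + 2 * j + 1, (compApply_zero_infix_add_two hpos n j).trans ?_⟩
  rw [compApply_succ_two]
  exact (infix_compApply_of_mem k _ (List.mem_replicate.2 ⟨by omega, rfl⟩)).trans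
    (List.suffix_append _ _).isInfix

theorem exists_one_infix_compApply (hpos : ∀ i, 1 ≤ i → 1 ≤ k i) (hstar : StarCond k) (n : ℕ) :
    ∃ N, compApply k n [1] <:+: compApply k N [2] := by
  rw [← compApply_succ_zero]
  exact exists_zero_infix_compApply hpos hstar (n + 1)

theorem length_lt_of_zero_notMem (hpos : ∀ i, 1 ≤ i → 1 ≤ k i) (hstar : StarCond k)
    (hρ : ∀ n, IsPrefixSeq (compApply k n [2]) ρ) {L : ℕ}
    (hL : ∀ p l m, window ρ p l <:+: window ρ m (L * l)) {n N : ℕ} {u : List (Fin 3)}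
    (hu : compApply k n u <:+: compApply k N [2]) (h0 : (0 : Fin 3) ∉ u) :
    (compApply k n u).length < L * (compApply k n [0]).length := by
  by_contra! hle
  obtain ⟨N', hN'⟩ := exists_zero_infix_compApply hpos hstar n
  rw [compApply_eq_window hρ] at hu hN'
  obtain ⟨q, hq⟩ := exists_eq_window_of_infix_window hu
  obtain ⟨p, hp⟩ := exists_eq_window_of_infix_window hN'
  refine h0 (zero_mem_of_compApply_infix_compApply hpos (n := n) ?_)
  rw [hq, hp]
  exact (hL _ _ q).trans (window_infix_window ρ le_rfl (by omega))

theorem length_zero_le_two_mul_length_two {n : ℕ} (hk : 1 < k (n + 1)) :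
    (compApply k (n + 2) [0]).length ≤ 2 * (compApply k (n + 2) [2]).length := by
  have h := length_two_mono k (Nat.le_succ (n + 1))
  dsimp only at h
  rw [length_succ_two] at h
  rw [length_succ_zero, length_succ_one]
  obtain ⟨t, ht⟩ : ∃ t, k (n + 1) = t + 2 := ⟨k (n + 1) - 2, by omega⟩
  rw [ht] at h ⊢
  simp only [show t + 2 - 1 = t + 1 by omega] at h
  change _ ≤ 2 * (compApply k (n + 1).succ [2]).length
  nlinarith

theorem length_zero_le_two_mul_length_one (hpos : ∀ i, 1 ≤ i → 1 ≤ k i) (n : ℕ) :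
    (compApply k n [0]).length ≤ 2 * (compApply k n [1]).length := by
  induction n using Nat.twoStepInduction with
  | zero => simp [compApply]
  | one =>
    have := length_compApply_pos k 1 (v := [1]) (by simp)
    rw [length_succ_zero k 0]
    simp only [compApply, List.length_singleton] at this ⊢
    omega
  | more n ih _ =>
    have h₁ := length_succ_one k (n + 1)
    have h₂ := length_succ_zero k n
    have h₃ := length_two_mono k n.le_succ
    have h₄ := length_succ_one k n
    have h₅ := length_succ_zero k (n + 1)
    have h₆ := length_succ_two k n
    have hk' := hpos (n + 2) (by omega)
    dsimp only at h₃
    simp only [Nat.succ_eq_add_one, show n + 1 + 1 = n + 2 by omega] at *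
    rcases (hpos (n + 1) (by omega)).eq_or_lt with hk | hk
    · rw [← hk] at h₄
      nlinarith
    · obtain ⟨t, ht⟩ : ∃ t, k (n + 1) = t + 2 := ⟨k (n + 1) - 2, by omega⟩
      rw [ht] at h₄ h₆
      simp only [show t + 2 - 1 = t + 1 by omega] at h₆
      nlinarith

theorem bound_of_recurrent (hpos : ∀ i, 1 ≤ i → 1 ≤ k i) (hstar : StarCond k)
    (hρ : ∀ n, IsPrefixSeq (compApply k n [2]) ρ) {L : ℕ}
    (hL : ∀ p l m, window ρ p l <:+: window ρ m (L * l)) (n : ℕ) : k (n + 2) < 2 * L := by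
  obtain ⟨N, hN⟩ := exists_one_infix_compApply hpos hstar (n + 2)
  have hin : compApply k n (List.replicate (k (n + 2)) 1) <:+: compApply k N [2] := by
    refine List.IsInfix.trans ?_ hN
    have : compApply k (n + 1) (List.replicate (k (n + 2)) 0) =
        compApply k n (List.replicate (k (n + 2)) 1) := by
      simp [compApply, applyChi, List.flatMap_replicate, chiSub]
    change _ <:+: compApply k (n + 1 + 1) [1]
    rw [compApply_succ_one, ← this]
    exact (List.suffix_append _ _).isInfix
  have h := length_lt_of_zero_notMem hpos hstar hρ hL hin (by simp [List.mem_replicate])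
  rw [length_compApply_replicate] at h
  have h1 := length_zero_le_two_mul_length_one hpos n
  have hlt : k (n + 2) * (compApply k n [1]).length <
      2 * L * (compApply k n [1]).length := by nlinarith
  exact lt_of_mul_lt_mul_right hlt (Nat.zero_le _)

theorem zero_notMem_compApply {k : ℕ → ℕ} {m : ℕ} (h : ∀ i < m, k (2 * i + 1) = 1)
    {w : List (Fin 3)} (hw : (0 : Fin 3) ∉ w) : (0 : Fin 3) ∉ compApply k (2 * m) w := by
  induction m generalizing w with
  | zero => exact hw
  | succ m ih =>
    change 0 ∉ compApply k (2 * m) (applyChi (k (2 * m + 1)) (applyChi (k (2 * m + 2)) w))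
    refine ih (fun i hi => h i (by omega)) ?_
    rw [h m (by omega)]
    simp only [applyChi, List.mem_flatMap, not_exists, not_and]
    rintro b ⟨c, hc, hb⟩
    fin_cases b
    · simp [chiSub]
    · fin_cases c <;> simp_all [chiSub, List.mem_replicate]
    · simp [chiSub]

theorem mul_length_two_le_length_one {n m : ℕ} (hpos : ∀ i, 1 ≤ i → 1 ≤ k i) :
    m * (compApply k n [2]).length ≤ (compApply k (n + 2 * m) [1]).length := by
  induction m with
  | zero => simp
  | succ m ih =>
    have h₁ := length_succ_one k (n + 2 * m + 1)
    have h₂ := length_succ_zero k (n + 2 * m)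
    have h₃ := length_two_mono k (show n ≤ n + 2 * m + 1 by omega)
    have h₄ := hpos (n + 2 * m + 1 + 1) (by omega)
    dsimp only at h₃
    change _ ≤ (compApply k (n + 2 * m + 1 + 1) [1]).length
    nlinarith

theorem gap_of_recurrent (hpos : ∀ i, 1 ≤ i → 1 ≤ k i) (hstar : StarCond k)
    (hρ : ∀ n, IsPrefixSeq (compApply k n [2]) ρ) {L : ℕ}
    (hL : ∀ p l m, window ρ p l <:+: window ρ m (L * l)) (n : ℕ) :
    ∃ j < 2 * L, 1 < k (n + 2 * j + 1) := by
  have key : ∀ n, (compApply k n [0]).length ≤ 2 * (compApply k n [2]).length →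
      ∃ j < 2 * L, 1 < k (n + 2 * j + 1) := by
    intro n hn
    by_contra! hcon
    obtain ⟨N, hN⟩ := exists_one_infix_compApply hpos hstar (n + 2 * (2 * L))
    have hlen := mul_length_two_le_length_one (n := n) (m := 2 * L) hpos
    rw [compApply_add] at hN hlen
    have := length_lt_of_zero_notMem hpos hstar hρ hL hN <| by
      refine zero_notMem_compApply (fun i hi => ?_) (by simp)
      exact le_antisymm (hcon i hi) (hpos _ (by omega))
    nlinarith
  induction n using Nat.twoStepInduction with
  | zero => exact key 0 (by simp [compApply])
  | one =>
    refine key 1 ?_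
    have := length_compApply_pos k 1 (v := [2]) (by simp)
    rw [length_succ_zero k 0]
    simp only [compApply, List.length_singleton] at this ⊢
    omega
  | more n ih _ =>
    rcases (hpos (n + 1) (by omega)).eq_or_lt with hk | hk
    · obtain ⟨j, hj, h⟩ := ih
      rcases j with _ | j
      · simp [← hk] at h
      · exact ⟨j, by omega, by convert h using 2; ring⟩
    · exact key _ (length_zero_le_two_mul_length_two hk)

end Necessity

section Covering

variable {α β : Type*} {f : α → List β} {K : ℕ}

theorem exists_append_of_flatMap_eq (hK : ∀ a, (f a).length ≤ K) {v : List α} {x r : List β}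
    (h : v.flatMap f = x ++ r) :
    ∃ (v' : List α) (s : List β), r = s ++ v'.flatMap f ∧ s.length ≤ K := by
  induction v generalizing x with
  | nil =>
    have : r = [] := by simp at h; exact h.2
    exact ⟨[], [], by simp [this]⟩
  | cons a v ih =>
    rw [List.flatMap_cons] at h
    rcases List.append_eq_append_iff.1 h with ⟨x', -, h'⟩ | ⟨c, hc, h'⟩
    · exact ih h'
    · refine ⟨v, c, h', ?_⟩
      have := hK a
      rw [hc, List.length_append] at this
      omega

theorem exists_append_infix_of_infix_flatMap (hK : ∀ a, (f a).length ≤ K) (hK0 : 0 < K)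
    {v : List α} {u : List β} (h : u <:+: v.flatMap f) (hu : 3 * K ≤ u.length) :
    ∃ b c, f b ++ f c <:+: u := by
  obtain ⟨x, y, hxy⟩ := h
  rw [List.append_assoc] at hxy
  obtain ⟨v', s, hs, hsK⟩ := exists_append_of_flatMap_eq hK hxy.symm
  have hlen := congrArg List.length hs
  simp only [List.length_append] at hlen
  rcases v' with _ | ⟨b, _ | ⟨c, v'⟩⟩
  · simp at hlen
    omega
  · have := hK b
    simp at hlen
    omega
  · refine ⟨b, c, ?_⟩
    have hb := hK b
    have hc := hK c
    have hp : s ++ (f b ++ f c) <+: u := by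
      refine List.prefix_of_prefix_length_le (l₃ := u ++ y) ?_ (List.prefix_append _ _) ?_
      · rw [hs]
        exact ⟨v'.flatMap f, by simp⟩
      · simp only [List.length_append]
        omega
    exact (List.suffix_append _ _).isInfix.trans hp.isInfix

end Covering

section Sufficiency

variable {k : ℕ → ℕ} {ρ : ℕ → Fin 3}

theorem exists_infix_compApply_of_infix_compApply {n : ℕ} {v w : List (Fin 3)}
    (hw : w <:+: compApply k (n + 2) v ++ compApply k n [2])
    (hlen : w.length ≤ (compApply k n [2]).length) :
    ∃ a, w <:+: compApply k (n + 2) [a] ++ compApply k n [2] := by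
  induction v with
  | nil =>
    rw [compApply_nil, List.nil_append] at hw
    exact ⟨0, hw.trans (List.suffix_append _ _).isInfix⟩
  | cons a v ih =>
    have hpre : compApply k n [2] <+: compApply k (n + 2) v ++ compApply k n [2] := by
      rcases v with _ | ⟨b, v⟩
      · simp
      · exact (compApply_two_prefix_add_two k n (by simp)).trans (List.prefix_append _ _)
    obtain ⟨x, y, hxy⟩ := hw
    rw [compApply_cons, List.append_assoc, List.append_assoc] at hxy
    rcases List.append_eq_append_iff.1 hxy.symm with ⟨x', -, h'⟩ | ⟨c, hc, h'⟩
    · exact ih ⟨x', y, by rw [h', List.append_assoc]⟩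
    · refine ⟨a, ?_⟩
      have : w <+: c ++ compApply k n [2] := by
        refine List.prefix_of_prefix_length_le (List.prefix_append w y) ?_
          (by rw [List.length_append]; omega)
        rw [h']
        exact (List.prefix_append_right_inj c).2 hpre
      rw [hc, List.append_assoc]
      exact this.isInfix.trans (List.suffix_append _ _).isInfix

theorem mem_compApply_trans {n m m' : ℕ} {a b c : Fin 3}
    (hab : a ∈ compApply (fun i => k (n + i)) m [b])
    (hbc : b ∈ compApply (fun i => k (n + m + i)) m' [c]) :
    a ∈ compApply (fun i => k (n + i)) (m + m') [c] := by
  rw [compApply_add, compApply_eq_flatMap, List.mem_flatMap]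
  exact ⟨b, by simpa only [add_assoc] using hbc, hab⟩

theorem two_mem_compApply (k : ℕ → ℕ) {m : ℕ} (hm : 2 ≤ m) (b : Fin 3) :
    (2 : Fin 3) ∈ compApply k m [b] := by
  obtain ⟨m, rfl⟩ := Nat.exists_eq_add_of_le' hm
  have h := (compApply_two_prefix_of_le k m.zero_le).trans
    (compApply_two_prefix_add_two k m (List.cons_ne_nil b []))
  exact h.subset (by simp [compApply])

theorem zero_mem_compApply_two_mul (hpos : ∀ i, 1 ≤ i → 1 ≤ k i) (j : ℕ) :
    (0 : Fin 3) ∈ compApply k (2 * j) [0] := by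
  have := compApply_zero_infix_add_two hpos 0 j
  rw [zero_add] at this
  exact this.subset (by simp [compApply])

theorem zero_mem_compApply_of_gap (hpos : ∀ i, 1 ≤ i → 1 ≤ k i) {N : ℕ}
    (hgap : ∀ n, ∃ j ≤ N, 1 < k (n + 2 * j + 1)) (n : ℕ) {m : ℕ} (hm : 2 * N + 3 ≤ m)
    (b : Fin 3) : (0 : Fin 3) ∈ compApply (fun i => k (n + i)) m [b] := by
  obtain ⟨j, hj, hk⟩ := hgap n
  obtain ⟨r, rfl⟩ : ∃ r, m = 2 * j + (1 + r) := ⟨m - 2 * j - 1, by omega⟩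
  refine mem_compApply_trans (zero_mem_compApply_two_mul (fun i hi => hpos _ (by omega)) j) ?_
  refine mem_compApply_trans (b := 2) ?_ (two_mem_compApply _ (by omega) b)
  simp only [compApply, applyChi, chiSub]
  simp [List.mem_replicate]
  omega

theorem mem_compApply_of_gap (hpos : ∀ i, 1 ≤ i → 1 ≤ k i) {N : ℕ}
    (hgap : ∀ n, ∃ j ≤ N, 1 < k (n + 2 * j + 1)) (n : ℕ) (a b : Fin 3) :
    a ∈ compApply (fun i => k (n + i)) (2 * N + 4) [b] := by
  fin_cases a
  · exact zero_mem_compApply_of_gap hpos hgap n (by omega) b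
  · rw [show 2 * N + 4 = 1 + (2 * N + 3) by ring]
    exact mem_compApply_trans (b := 0) (by simp [compApply, applyChi, chiSub])
      (zero_mem_compApply_of_gap hpos hgap (n + 1) le_rfl b)
  · exact two_mem_compApply _ (by omega) b

/-- The total length of the images of the three letters. -/
def totalLength (k : ℕ → ℕ) (n : ℕ) : ℕ :=
  (compApply k n [0]).length + (compApply k n [1]).length + (compApply k n [2]).length

theorem length_le_totalLength (k : ℕ → ℕ) (n : ℕ) (a : Fin 3) :
    (compApply k n [a]).length ≤ totalLength k n := by
  fin_cases a <;> simp only [totalLength] <;> dsimp <;> omega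

theorem totalLength_add_le {B : ℕ} (hB : ∀ i, 1 ≤ i → k i ≤ B) (n m : ℕ) :
    totalLength k (n + m) ≤ (2 * B + 2) ^ m * totalLength k n := by
  induction m with
  | zero => simp
  | succ m ih =>
    have step : totalLength k (n + m + 1) ≤ (2 * B + 2) * totalLength k (n + m) := by
      have h := hB (n + m + 1) (by omega)
      have h' : k (n + m + 1) - 1 ≤ B := by omega
      simp only [totalLength, length_succ_zero, length_succ_one, length_succ_two]
      have h₁ := Nat.mul_le_mul_right (compApply k (n + m) [0]).length h
      have h₂ := Nat.mul_le_mul_right (compApply k (n + m) [0]).length h'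
      nlinarith
    calc totalLength k (n + m + 1) ≤ (2 * B + 2) * totalLength k (n + m) := step
      _ ≤ (2 * B + 2) * ((2 * B + 2) ^ m * totalLength k n) := Nat.mul_le_mul_left _ ih
      _ = (2 * B + 2) ^ (m + 1) * totalLength k n := by ring

theorem totalLength_le_mul_length_two {B M : ℕ} (hB : ∀ i, 1 ≤ i → k i ≤ B)
    (hM : ∀ n a b, a ∈ compApply (fun i => k (n + i)) M [b]) (n : ℕ) :
    totalLength k n ≤ 3 * (2 * B + 2) ^ M * (compApply k n [2]).length := by
  rcases le_total M n with h | h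
  · obtain ⟨n, rfl⟩ := Nat.exists_eq_add_of_le' h
    have h3 : totalLength k n ≤ 3 * (compApply k (n + M) [2]).length := by
      rw [compApply_add]
      have h₀ := (infix_compApply_of_mem k n (hM n 0 2)).length_le
      have h₁ := (infix_compApply_of_mem k n (hM n 1 2)).length_le
      have h₂ := (infix_compApply_of_mem k n (hM n 2 2)).length_le
      simp only [totalLength]
      omega
    calc _ ≤ _ := totalLength_add_le hB n M
      _ ≤ _ := Nat.mul_le_mul_left _ h3
      _ = _ := by ring
  · have h1 := totalLength_add_le hB 0 n
    have h2 : totalLength k 0 = 3 := by simp [totalLength, compApply]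
    have h3 := length_compApply_pos k n (v := [2]) (by simp)
    rw [zero_add, h2] at h1
    calc _ ≤ _ := h1
      _ ≤ (2 * B + 2) ^ M * 3 := Nat.mul_le_mul_right _ (Nat.pow_le_pow_right (by omega) h)
      _ = 3 * (2 * B + 2) ^ M * 1 := by ring
      _ ≤ _ := Nat.mul_le_mul_left _ h3

theorem exists_le_length_two (hstar : StarCond k) (l : ℕ) :
    ∃ n, l ≤ (compApply k n [2]).length := by
  induction l with
  | zero => exact ⟨0, Nat.zero_le _⟩
  | succ l ih =>
    obtain ⟨n, hn⟩ := ih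
    obtain ⟨i, hi, hk⟩ := hstar.1 (n + 1)
    obtain ⟨m, hm⟩ : ∃ m, 2 * i = m + 1 := ⟨2 * i - 1, by omega⟩
    rw [hm] at hk
    refine ⟨m + 1, ?_⟩
    have h₁ := length_two_mono k (show n ≤ m by omega)
    have h₂ := length_compApply_pos k m (v := [0]) (by simp)
    have h₃ : 1 ≤ k (m + 1) - 1 := by omega
    dsimp only at h₁
    rw [length_succ_two]
    nlinarith

theorem window_infix_compApply (hstar : StarCond k)
    (hρ : ∀ n, IsPrefixSeq (compApply k n [2]) ρ) (n p l : ℕ) :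
    ∃ v, window ρ p l <:+: compApply k n v := by
  obtain ⟨N, hN⟩ := exists_le_length_two hstar (p + l)
  have hmono := length_two_mono k (Nat.le_add_left N n)
  dsimp only at hmono
  refine ⟨compApply (fun i => k (n + i)) N [2], ?_⟩
  rw [← compApply_add, compApply_eq_window hρ]
  exact window_infix_window ρ p.zero_le (by omega)

theorem infix_append_of_mem {n M : ℕ} {a b : Fin 3} (c : Fin 3)
    (h : a ∈ compApply (fun i => k (n + 2 + i)) M [b]) :
    compApply k (n + 2) [a] ++ compApply k n [2] <:+:
      compApply k (n + 2 + M) [b] ++ compApply k (n + 2 + M) [c] := by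
  rw [compApply_add k (n + 2) M [b], compApply_add k (n + 2) M [c]]
  obtain ⟨s, t, hst⟩ := List.append_of_mem h
  have hne : t ++ compApply (fun i => k (n + 2 + i)) M [c] ≠ [] := by
    have := length_compApply_pos (fun i => k (n + 2 + i)) M (v := [c]) (by simp)
    exact List.append_ne_nil_of_right_ne_nil _ (List.length_pos_iff.1 this)
  obtain ⟨r, hr⟩ := compApply_two_prefix_add_two k n hne
  refine ⟨compApply k (n + 2) s, r, ?_⟩
  rw [hst, ← compApply_append, List.append_assoc s, List.cons_append, compApply_append k _ s,
    compApply_cons k (n + 2) a (_ ++ _), ← hr]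
  simp

theorem recurrent_of_bound_of_gap (hpos : ∀ i, 1 ≤ i → 1 ≤ k i) (hstar : StarCond k)
    (hρ : ∀ n, IsPrefixSeq (compApply k n [2]) ρ) {B N : ℕ} (hB : ∀ i, 1 ≤ i → k i ≤ B)
    (hgap : ∀ n, ∃ j ≤ N, 1 < k (n + 2 * j + 1)) :
    ∃ L, ∀ p l m, window ρ p l <:+: window ρ m (L * l) := by
  have hM := mem_compApply_of_gap hpos hgap
  set M := 2 * N + 4
  set D := 2 * B + 2 with hD
  refine ⟨3 * (D ^ (2 + M) * (3 * D ^ (M + 1))), fun p l m => ?_⟩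
  rcases l.eq_zero_or_pos with rfl | hl
  · have : window ρ p 0 = [] := by simp [window]
    simp [this]
  obtain ⟨n, hn, hS⟩ : ∃ n, l ≤ (compApply k n [2]).length ∧
      totalLength k n ≤ 3 * D ^ (M + 1) * l := by
    have hex := exists_le_length_two hstar l
    refine ⟨Nat.find hex, Nat.find_spec hex, ?_⟩
    rcases hf : Nat.find hex with _ | n
    · have h2 : totalLength k 0 = 3 := by simp [totalLength, compApply]
      have h3 : 1 ≤ D ^ (M + 1) := Nat.one_le_pow _ _ (by omega)
      rw [h2]
      nlinarith
    · have hlt := not_le.1 (Nat.find_min hex (show n < Nat.find hex by omega))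
      calc _ ≤ _ := totalLength_add_le hB n 1
        _ ≤ _ := Nat.mul_le_mul_left _ (totalLength_le_mul_length_two hB hM n)
        _ ≤ _ := Nat.mul_le_mul_left _ (Nat.mul_le_mul_left _ hlt.le)
        _ = _ := by rw [← hD]; ring
  have hS' : totalLength k (n + 2 + M) ≤ D ^ (2 + M) * (3 * D ^ (M + 1)) * l := by
    rw [add_assoc, mul_assoc]
    exact (totalLength_add_le hB n (2 + M)).trans (Nat.mul_le_mul_left _ hS)
  obtain ⟨v, hv⟩ := window_infix_compApply hstar hρ (n + 2) p l
  obtain ⟨a, ha⟩ := exists_infix_compApply_of_infix_compApply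
    (hv.trans (List.prefix_append _ _).isInfix) (by simpa using hn)
  obtain ⟨v', hv'⟩ := window_infix_compApply hstar hρ (n + 2 + M) m
    (3 * (D ^ (2 + M) * (3 * D ^ (M + 1))) * l)
  rw [compApply_eq_flatMap] at hv'
  obtain ⟨b, c, hbc⟩ := exists_append_infix_of_infix_flatMap
    (length_le_totalLength k (n + 2 + M))
    ((length_compApply_pos k _ (List.cons_ne_nil 0 [])).trans_le
      (length_le_totalLength k (n + 2 + M) 0)) hv'
    (by rw [length_window, mul_assoc 3]; exact Nat.mul_le_mul_left _ hS')
  exact ha.trans ((infix_append_of_mem c (hM _ a b)).trans hbc)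

end Sufficiency

/-- the subshift `(X,σ)` is linearly recurrent iff `(k_i)` is bounded and
both sets `{i : k_{2i} > 1}` and `{i : k_{2i-1} > 1}` have bounded gaps. -/
theorem statement4 (k : ℕ → ℕ) (hpos : ∀ i, 1 ≤ i → 1 ≤ k i) (hstar : StarCond k)
    (ρ : ℕ → Fin 3) (hρ : ∀ n : ℕ, IsPrefixSeq (compApply k n [2]) ρ) :
    LinearlyRecurrent (orbitClosure ρ) ↔
      ((∃ B : ℕ, ∀ i, 1 ≤ i → k i ≤ B) ∧
        ∃ N : ℕ, ∀ i, 1 ≤ i →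
          (∃ j, i ≤ j ∧ j ≤ i + N ∧ 1 < k (2 * j)) ∧
          (∃ j', i ≤ j' ∧ j' ≤ i + N ∧ 1 < k (2 * j' - 1))) := by
  rw [linearlyRecurrent_orbitClosure_iff]
  constructor
  · rintro ⟨L, hL⟩
    refine ⟨⟨k 1 + 2 * L, fun i hi => ?_⟩, 2 * L, fun i hi => ⟨?_, ?_⟩⟩
    · obtain rfl | ⟨n, rfl⟩ : i = 1 ∨ ∃ n, i = n + 2 := by
        rcases hi.eq_or_lt with h | h
        · exact Or.inl h.symm
        · exact Or.inr ⟨i - 2, by omega⟩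
      · exact Nat.le_add_right _ _
      · have := bound_of_recurrent hpos hstar hρ hL n
        omega
    · obtain ⟨j, hj, h⟩ := gap_of_recurrent hpos hstar hρ hL (2 * i - 1)
      exact ⟨i + j, by omega, by omega, by convert h using 2; omega⟩
    · obtain ⟨j, hj, h⟩ := gap_of_recurrent hpos hstar hρ hL (2 * i - 2)
      exact ⟨i + j, by omega, by omega, by convert h using 2; omega⟩
  · rintro ⟨⟨B, hB⟩, N, hN⟩
    refine recurrent_of_bound_of_gap hpos hstar hρ hB (N := N) fun n => ?_
    obtain ⟨s, rfl | rfl⟩ := n.even_or_odd'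
    · obtain ⟨-, j, h₁, h₂, h⟩ := hN (s + 1) (by omega)
      exact ⟨j - (s + 1), by omega, by convert h using 2; omega⟩
    · obtain ⟨⟨j, h₁, h₂, h⟩, -⟩ := hN (s + 1) (by omega)
      exact ⟨j - (s + 1), by omega, by convert h using 2; omega⟩
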